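/- Let (M,g,J,ω) be an almost Hermitian manifold and ψ ∈ Aut(TM) a g-Codazzi map. Then for all vector fields X,Y,Z, (dω^ψ)(X,Y,Z) = (∇^g_X ω)(ψ^{-1}Y, ψ^{-1}Z) + (∇^g_Y ω)(ψ^{-1}Z, ψ^{-1}X) + (∇^g_Z ω)(ψ^{-1}X, ψ^{-1}Y), where ω^ψ := ω(ψ^{-1}·, ψ^{-1}·). -/

import Mathlib

universe u v

variable {C : Type u} {V : Type v} [CommRing C] [AddCommGroup V] [Module C V] [LieRing V]

/-- Abstract axioms of the Riemannian-manifold setting: `C` plays the role of the ring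
`C^∞(M)` of smooth functions, `V` the `C^∞(M)`-module of vector fields with its Lie
bracket, `D X f` is the action of the vector field `X` on the function `f` (derivation),
`g` is the Riemannian metric and `cn` its Levi-Civita connection. -/
structure RiemannSetting (D : V → C → C) (g : V →ₗ[C] V →ₗ[C] C)
    (cn : V → V → V) : Prop where
  D_add : ∀ (X : V) (f₁ f₂ : C), D X (f₁ + f₂) = D X f₁ + D X f₂
  D_mul : ∀ (X : V) (f₁ f₂ : C), D X (f₁ * f₂) = D X f₁ * f₂ + f₁ * D X f₂
  D_addX : ∀ (X Y : V) (f : C), D (X + Y) f = D X f + D Y f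
  D_smulX : ∀ (f : C) (X : V) (k : C), D (f • X) k = f * D X k
  D_bracket : ∀ (X Y : V) (f : C), D ⁅X, Y⁆ f = D X (D Y f) - D Y (D X f)
  g_symm : ∀ X Y : V, g X Y = g Y X
  g_nondeg : ∀ X : V, (∀ Y : V, g X Y = 0) → X = 0
  cn_addX : ∀ X Y Z : V, cn (X + Y) Z = cn X Z + cn Y Z
  cn_smulX : ∀ (f : C) (X Y : V), cn (f • X) Y = f • cn X Y
  cn_addY : ∀ X Y Z : V, cn X (Y + Z) = cn X Y + cn X Z
  cn_leibniz : ∀ (X : V) (f : C) (Y : V), cn X (f • Y) = D X f • Y + f • cn X Y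
  torsion_free : ∀ X Y : V, cn X Y - cn Y X = ⁅X, Y⁆
  metric_compat : ∀ X Y Z : V, D X (g Y Z) = g (cn X Y) Z + g Y (cn X Z)

/-- `ψ` is a `g`-Codazzi map: `(∇_X ψ⁻¹)Y = (∇_Y ψ⁻¹)X`. -/
def IsCodazziMap (cn : V → V → V) (ψ : V ≃ₗ[C] V) : Prop :=
  ∀ X Y : V, cn X (ψ.symm Y) - ψ.symm (cn X Y) = cn Y (ψ.symm X) - ψ.symm (cn Y X)

/-- The twisted metric `g^ψ := g(ψ⁻¹·, ψ⁻¹·)`. -/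
def twistedMetric (g : V →ₗ[C] V →ₗ[C] C) (ψ : V ≃ₗ[C] V) : V →ₗ[C] V →ₗ[C] C :=
  g.compl₁₂ ψ.symm.toLinearMap ψ.symm.toLinearMap

/-- The curvature endomorphism `R(X,Y)Z` of a connection `cn`. -/
def curv (cn : V → V → V) (X Y Z : V) : V :=
  cn X (cn Y Z) - cn Y (cn X Z) - cn ⁅X, Y⁆ Z


/-- The exterior derivative of a 2-form `β`, expressed via the actions `D` of vector
fields on functions and the Lie bracket:
`dβ(X,Y,Z) = Xβ(Y,Z) − Yβ(X,Z) + Zβ(X,Y) − β([X,Y],Z) + β([X,Z],Y) − β([Y,Z],X)`. -/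
def extDer2 (D : V → C → C) (β : V → V → C) (X Y Z : V) : C :=
  D X (β Y Z) - D Y (β X Z) + D Z (β X Y)
    - β ⁅X, Y⁆ Z + β ⁅X, Z⁆ Y - β ⁅Y, Z⁆ X

/-- The covariant derivative `(∇_X β)(A,B) := X β(A,B) − β(∇_X A, B) − β(A, ∇_X B)`. -/
def covDer2 (D : V → C → C) (cn : V → V → V) (β : V → V → C) (X A B : V) : C :=
  D X (β A B) - β (cn X A) B - β A (cn X B)

/-- For an almost Hermitian manifold `(M,g,J,ω)` with `ω = g(J·,·)` and
a `g`-Codazzi map `ψ`, the twisted fundamental form `ω^ψ := ω(ψ⁻¹·,ψ⁻¹·)` satisfies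
`(dω^ψ)(X,Y,Z) = (∇_X ω)(ψ⁻¹Y,ψ⁻¹Z) + (∇_Y ω)(ψ⁻¹Z,ψ⁻¹X) + (∇_Z ω)(ψ⁻¹X,ψ⁻¹Y)`. -/
theorem twisted_fundamental_form_exterior_derivative
    (D : V → C → C) (g : V →ₗ[C] V →ₗ[C] C) (cn : V → V → V)
    (hg : RiemannSetting D g cn)
    (J : V →ₗ[C] V)
    (hJ2 : ∀ X : V, J (J X) = -X)
    (hJg : ∀ X Y : V, g (J X) (J Y) = g X Y)
    (ψ : V ≃ₗ[C] V) (hψ : IsCodazziMap cn ψ) :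
    ∀ X Y Z : V,
      extDer2 D (fun A B => g (J (ψ.symm A)) (ψ.symm B)) X Y Z
        = covDer2 D cn (fun A B => g (J A) B) X (ψ.symm Y) (ψ.symm Z)
          + covDer2 D cn (fun A B => g (J A) B) Y (ψ.symm Z) (ψ.symm X)
          + covDer2 D cn (fun A B => g (J A) B) Z (ψ.symm X) (ψ.symm Y) := by
  intro X Y Z
  have hw : ∀ A B : V, g (J A) B = - g (J B) A := by
    intro A B
    rw [← hJg (J A) B, hJ2, map_neg, LinearMap.neg_apply, hg.g_symm A (J B)]
  have D0 : ∀ U : V, D U 0 = 0 := by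
    intro U
    have h := hg.D_add U 0 0
    rw [add_zero] at h
    exact left_eq_add.mp h
  have Dneg : ∀ (U : V) (f : C), D U (-f) = - D U f := by
    intro U f
    have h := hg.D_add U (-f) f
    rw [neg_add_cancel, D0] at h
    exact eq_neg_of_add_eq_zero_left h.symm
  have hP : ∀ A B : V, ψ.symm ⁅A, B⁆ = cn A (ψ.symm B) - cn B (ψ.symm A) := by
    intro A B
    rw [← hg.torsion_free, map_sub]
    have h := hψ A B
    rw [sub_eq_sub_iff_add_eq_add] at h ⊢
    rw [add_comm, add_comm (cn A _), add_comm] at *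
    first
      | exact h.symm
      | (rw [add_comm, ← h, add_comm])
      | grind
  simp only [extDer2, covDer2, hP, map_sub, LinearMap.sub_apply]
  rw [hw (ψ.symm X) (ψ.symm Z), Dneg, hw (ψ.symm Y) (cn X _), hw (ψ.symm Z) (cn Y _),
    hw (ψ.symm X) (cn Z _)]
  ring
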